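/- For any two elements w, y ∈ W̃, the equality ℓ̃(y) + ℓ̃(w) = ℓ̃(y w) holds if and only if the equality ℓ(y) + ℓ(w) = ℓ(y w) holds, where ℓ is the length function of (W, S) and ℓ̃ is the word length on W̃ with respect to S̃. -/

import Mathlib

/-!
Relative Coxeter groups: common definitions.

`(W, S)` is a Coxeter system (Mathlib's `CoxeterSystem M W`), `ℓ = cs.length`.
For `w : W`, `invSet cs w` is the set `T(w)` of left inversions of `w`, and
`descSet cs w = T(w) ∩ S` is `D(w)`.  For a subset `Sg ⊆ S` (playing the role of `Σ`),
`par Sg` is the standard parabolic subgroup `W_Σ`, `parRefl Sg` its set of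
reflections `T_Σ`, `minRight cs Sg = W^Σ`, `minLeft cs Sg = ^ΣW`,
`relN cs Sg Sg' = N(Σ, Σ')`, `IsLongest cs Sg w` says `w` is a longest element of `W_Σ`,
`longest cs Sg` is the longest element `w₀^Σ`, `relW cs Sg = W̃`,
`complSet cs Sg = Σ^∁`, `tilde cs Sg s = s̃ = w₀^{Σ∪{s}} w₀^Σ`, `relS cs Sg = S̃`,
`relLength cs Sg = ℓ̃ : W → ℕ∞`, and `GoodSubset cs Sg` records the standing
hypotheses (1) and (2) on `Σ`.
-/

namespace RelativeCoxeter

variable {B W : Type*} [Group W] {M : CoxeterMatrix B}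

/-- The set `S` of simple reflections of the Coxeter system. -/
def simpleSet (cs : CoxeterSystem M W) : Set W := Set.range cs.simple

/-- `T(w)`: the set of left inversions of `w`, i.e. reflections `t` with `ℓ(tw) < ℓ(w)`. -/
def invSet (cs : CoxeterSystem M W) (w : W) : Set W :=
  {t | cs.IsReflection t ∧ cs.length (t * w) < cs.length w}

/-- `D(w) = T(w) ∩ S`. -/
def descSet (cs : CoxeterSystem M W) (w : W) : Set W :=
  invSet cs w ∩ simpleSet cs

/-- The standard parabolic subgroup `W_Σ` generated by `Σ`. -/
def par (Sg : Set W) : Subgroup W := Subgroup.closure Sg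

/-- `T_Σ`: the set of reflections of the Coxeter system `(W_Σ, Σ)`. -/
def parRefl (Sg : Set W) : Set W :=
  {t | ∃ u ∈ par Sg, ∃ s ∈ Sg, t = u * s * u⁻¹}

/-- `W^Σ = {w : T(w⁻¹) ∩ T_Σ = ∅}`, minimal-length representatives of `W/W_Σ`. -/
def minRight (cs : CoxeterSystem M W) (Sg : Set W) : Set W :=
  {w | invSet cs w⁻¹ ∩ parRefl Sg = ∅}

/-- `^ΣW = {w : T(w) ∩ T_Σ = ∅}`, minimal-length representatives of `W_Σ\W`. -/
def minLeft (cs : CoxeterSystem M W) (Sg : Set W) : Set W :=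
  {w | invSet cs w ∩ parRefl Sg = ∅}

/-- `N(Σ, Σ') = {y ∈ W^Σ ∩ ^{Σ'}W : y W_Σ y⁻¹ = W_{Σ'}}`. -/
def relN (cs : CoxeterSystem M W) (Sg Sg' : Set W) : Set W :=
  {y | y ∈ minRight cs Sg ∧ y ∈ minLeft cs Sg' ∧
    (fun u => y * u * y⁻¹) '' (par Sg : Set W) = (par Sg' : Set W)}

/-- `w` is a longest element of `W_Σ`. -/
def IsLongest (cs : CoxeterSystem M W) (Sg : Set W) (w : W) : Prop :=
  w ∈ par Sg ∧ ∀ u ∈ par Sg, cs.length u ≤ cs.length w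

/-- The longest element `w₀^Σ` of `W_Σ` (defined when it exists; junk value `1` otherwise). -/
noncomputable def longest (cs : CoxeterSystem M W) (Sg : Set W) : W :=
  letI := Classical.propDecidable (∃ w, IsLongest cs Sg w)
  if h : ∃ w, IsLongest cs Sg w then h.choose else 1

/-- `W̃ = {w : w W_Σ w⁻¹ = W_Σ and T(w) ∩ T_Σ = ∅}`. -/
def relW (cs : CoxeterSystem M W) (Sg : Set W) : Set W :=
  {w | (fun u => w * u * w⁻¹) '' (par Sg : Set W) = (par Sg : Set W) ∧
    invSet cs w ∩ parRefl Sg = ∅}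

/-- `Σ^∁ = {s ∈ S ∖ Σ : W_{Σ∪{s}} is finite}`. -/
def complSet (cs : CoxeterSystem M W) (Sg : Set W) : Set W :=
  {s ∈ simpleSet cs \ Sg | ((par (Sg ∪ {s}) : Set W)).Finite}

/-- `s̃ = w₀^{Σ∪{s}} w₀^Σ`. -/
noncomputable def tilde (cs : CoxeterSystem M W) (Sg : Set W) (s : W) : W :=
  longest cs (Sg ∪ {s}) * longest cs Sg

/-- `S̃ = {s̃ : s ∈ Σ^∁}`. -/
noncomputable def relS (cs : CoxeterSystem M W) (Sg : Set W) : Set W :=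
  {w | ∃ s ∈ complSet cs Sg, w = tilde cs Sg s}

/-- `ℓ̃(w) ∈ ℕ ∪ {∞}`: the minimal `q` such that `w = w₁ ⋯ w_q` with all `w_i ∈ S̃`. -/
noncomputable def relLength (cs : CoxeterSystem M W) (Sg : Set W) (w : W) : ℕ∞ :=
  sInf {q : ℕ∞ | ∃ l : List W, (∀ x ∈ l, x ∈ relS cs Sg) ∧ l.prod = w ∧
    (l.length : ℕ∞) = q}

/-- The standing hypotheses on `Σ`: `Σ ⊆ S`, `W_Σ` is finite, and for every `Σ'` with
`Σ ⊆ Σ' ⊆ S` and `W_{Σ'}` finite, the longest element `w₀^{Σ'}` normalises `W_Σ`. -/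
def GoodSubset (cs : CoxeterSystem M W) (Sg : Set W) : Prop :=
  Sg ⊆ simpleSet cs ∧ ((par Sg : Set W)).Finite ∧
  ∀ Sg' : Set W, Sg ⊆ Sg' → Sg' ⊆ simpleSet cs → ((par Sg' : Set W)).Finite →
    ∀ w0 : W, IsLongest cs Sg' w0 →
      (fun u => w0 * u * w0⁻¹) '' (par Sg : Set W) = (par Sg : Set W)

variable (cs : CoxeterSystem M W)

/-- The permutation of `W × ZMod 2` attached to a simple reflection; it conjugates the first
coordinate and records in the second one whether that coordinate is the reflection itself. -/
noncomputable def signPerm (i : B) : Equiv.Perm (W × ZMod 2) :=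
  letI := Classical.decEq W
  Function.Involutive.toPerm
    (fun p => (cs.simple i * p.1 * cs.simple i, p.2 + if p.1 = cs.simple i then 1 else 0))
    (by
      rintro ⟨t, e⟩
      have h : cs.simple i * t * cs.simple i = cs.simple i ↔ t = cs.simple i := by
        rw [mul_eq_right, mul_eq_one_iff_eq_inv', cs.inv_simple]
      simp only [h, Prod.mk.injEq]
      refine ⟨by simp [mul_assoc], ?_⟩
      rw [add_assoc, CharTwo.add_self_eq_zero, add_zero])

open Classical in
theorem signPerm_apply (i : B) (t : W) (e : ZMod 2) :
    signPerm cs i (t, e) =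
      (cs.simple i * t * cs.simple i, e + if t = cs.simple i then 1 else 0) := by
  simp only [signPerm]
  congr

open Classical in
theorem signPerm_mul_pow_apply (i j : B) (k : ℕ) (t : W) (e : ZMod 2) :
    ((signPerm cs i * signPerm cs j) ^ k) (t, e) =
      ((cs.simple i * cs.simple j) ^ k * t * ((cs.simple i * cs.simple j) ^ k)⁻¹,
        e + ∑ n ∈ Finset.range (2 * k),
          if t = (cs.simple j * cs.simple i) ^ n * cs.simple j then 1 else 0) := by
  induction k with
  | zero => simp
  | succ k ih =>
    have hinv : (cs.simple i * cs.simple j)⁻¹ = cs.simple j * cs.simple i := by simp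
    have hj : ∀ n, cs.simple j * (cs.simple i * cs.simple j) ^ n =
        (cs.simple j * cs.simple i) ^ n * cs.simple j := by
      intro n
      induction n with
      | zero => simp
      | succ n ihn => rw [pow_succ, ← mul_assoc, ihn, pow_succ]; simp only [mul_assoc]
    have hinvk : ((cs.simple i * cs.simple j) ^ k)⁻¹ = (cs.simple j * cs.simple i) ^ k := by
      rw [← inv_pow, hinv]
    rw [pow_succ', Equiv.Perm.mul_apply, ih, Equiv.Perm.mul_apply, signPerm_apply, signPerm_apply,
      show 2 * (k + 1) = 2 * k + 1 + 1 by ring, Finset.sum_range_succ, Finset.sum_range_succ]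
    have h1 : ((cs.simple i * cs.simple j) ^ k * t * ((cs.simple i * cs.simple j) ^ k)⁻¹ =
        cs.simple j) ↔ t = (cs.simple j * cs.simple i) ^ (2 * k) * cs.simple j := by
      rw [mul_inv_eq_iff_eq_mul, hj, ← eq_inv_mul_iff_mul_eq, hinvk, two_mul, pow_add, mul_assoc]
    have h2 : (cs.simple j * ((cs.simple i * cs.simple j) ^ k * t *
        ((cs.simple i * cs.simple j) ^ k)⁻¹) * cs.simple j = cs.simple i) ↔
        t = (cs.simple j * cs.simple i) ^ (2 * k + 1) * cs.simple j := by
      have : cs.simple j * ((cs.simple i * cs.simple j) ^ k * t *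
        ((cs.simple i * cs.simple j) ^ k)⁻¹) * cs.simple j =
        (cs.simple j * (cs.simple i * cs.simple j) ^ k) * t *
        (cs.simple j * (cs.simple i * cs.simple j) ^ k)⁻¹ := by
        simp [mul_assoc]
      rw [this, mul_inv_eq_iff_eq_mul, ← eq_inv_mul_iff_mul_eq, mul_inv_rev, hinvk, hj, two_mul,
        pow_succ, pow_add, cs.inv_simple]
      have hc : cs.simple j * cs.simple i * (cs.simple j * cs.simple i) ^ k
          = (cs.simple j * cs.simple i) ^ k * (cs.simple j * cs.simple i) :=
        (pow_mul_comm' _ _).symm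
      have : (cs.simple j * cs.simple i) ^ k * cs.simple j *
          (cs.simple i * ((cs.simple j * cs.simple i) ^ k * cs.simple j)) =
          (cs.simple j * cs.simple i) ^ k * (cs.simple j * cs.simple i *
          (cs.simple j * cs.simple i) ^ k) * cs.simple j := by
        simp only [mul_assoc]
      rw [this, hc]
      simp only [mul_assoc]
    simp only [h1, h2, Prod.mk.injEq]
    refine ⟨?_, by ring⟩
    rw [pow_succ' (cs.simple i * cs.simple j) k]
    simp [mul_assoc]

theorem isLiftable_signPerm : M.IsLiftable (signPerm cs) := by
  classical
  intro i j
  ext1 ⟨t, e⟩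
  rw [signPerm_mul_pow_apply, cs.simple_mul_simple_pow, two_mul, Finset.sum_range_add]
  simp only [pow_add, cs.simple_mul_simple_pow', one_mul]
  rw [CharTwo.add_self_eq_zero]
  simp

open Classical in
theorem lift_signPerm_wordProd (ω : List B) (t : W) (e : ZMod 2) :
    cs.lift ⟨signPerm cs, isLiftable_signPerm cs⟩ (cs.wordProd ω) (t, e) =
      (cs.wordProd ω * t * (cs.wordProd ω)⁻¹, e + ((cs.rightInvSeq ω).count t : ℕ)) := by
  induction ω with
  | nil => simp
  | cons i ω ih =>
    have h : cs.wordProd ω * t * (cs.wordProd ω)⁻¹ = cs.simple i ↔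
        (cs.wordProd ω)⁻¹ * cs.simple i * cs.wordProd ω = t := by
      rw [mul_inv_eq_iff_eq_mul, ← eq_inv_mul_iff_mul_eq, eq_comm, mul_assoc]
    rw [cs.wordProd_cons, map_mul, Equiv.Perm.mul_apply, ih, cs.lift_apply_simple, signPerm_apply,
      CoxeterSystem.rightInvSeq, List.count_cons]
    simp only [h, Prod.mk.injEq, beq_iff_eq]
    refine ⟨by simp [mul_assoc], ?_⟩
    push_cast
    rw [add_assoc]

/-- A reflection in the right inversion sequence of a reduced word occurs in the right inversion
sequence of every word with the same product. -/
theorem mem_rightInvSeq_of_wordProd_eq {ω ω' : List B} (hω : cs.IsReduced ω)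
    (h : cs.wordProd ω = cs.wordProd ω') {t : W}
    (ht : t ∈ cs.rightInvSeq ω) : t ∈ cs.rightInvSeq ω' := by
  classical
  have h1 := lift_signPerm_wordProd cs ω t 0
  rw [h, lift_signPerm_wordProd cs ω' t 0, List.count_eq_one_of_mem hω.nodup_rightInvSeq ht] at h1
  by_contra hn
  rw [List.count_eq_zero_of_not_mem hn] at h1
  simp at h1

/-- Exchange property for left descents. -/
theorem exists_simple_mul_eq_eraseIdx {ω : List B} {i : B}
    (hi : cs.length (cs.simple i * cs.wordProd ω) < cs.length (cs.wordProd ω)) :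
    ∃ j < ω.length, cs.simple i * cs.wordProd ω = cs.wordProd (ω.eraseIdx j) := by
  obtain ⟨ω₁, hω₁, h₁⟩ := cs.exists_isReduced (cs.simple i * cs.wordProd ω)
  have hprod : cs.wordProd (ω₁.reverse.concat i) = cs.wordProd ω.reverse := by
    rw [cs.wordProd_concat, cs.wordProd_reverse, cs.wordProd_reverse, ← h₁]
    simp
  have hred : cs.IsReduced (ω₁.reverse.concat i) := by
    have h2 := cs.isLeftDescent_iff.1 hi
    rw [h₁, hω₁.eq] at h2
    rw [CoxeterSystem.IsReduced, hprod, cs.wordProd_reverse, cs.length_inv, ← h2]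
    simp
  have hmem : cs.simple i ∈ cs.leftInvSeq ω := by
    have := mem_rightInvSeq_of_wordProd_eq cs hred hprod (t := cs.simple i)
      (by rw [cs.rightInvSeq_concat]; simp)
    simpa [cs.rightInvSeq_reverse] using this
  obtain ⟨j, hj, hji⟩ := List.mem_iff_getElem.1 hmem
  refine ⟨j, by simpa using hj, ?_⟩
  rw [← cs.getD_leftInvSeq_mul_wordProd, List.getD_eq_getElem _ _ hj, hji]

/-- Exchange property for a product `a * b`: a left descent of `a * b` either is a left
descent of `a`, or can be moved across `a` and then shortens `b`. -/
theorem exchange_mul {a b : W} {s : W}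
    (hs : s ∈ simpleSet cs) (h : cs.length (s * (a * b)) < cs.length (a * b)) :
    cs.length (s * a) < cs.length a ∨
      ∃ b', s * (a * b) = a * b' ∧ cs.length b' < cs.length b := by
  obtain ⟨i, rfl⟩ := hs
  obtain ⟨α, hα, rfl⟩ := cs.exists_isReduced a
  obtain ⟨β, hβ, rfl⟩ := cs.exists_isReduced b
  rw [← cs.wordProd_append] at h
  obtain ⟨j, hj, hji⟩ := exists_simple_mul_eq_eraseIdx cs h
  rw [cs.wordProd_append] at hji
  rcases lt_or_ge j α.length with hjα | hjα
  · left
    rw [List.eraseIdx_append_of_lt_length hjα, cs.wordProd_append, ← mul_assoc] at hji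
    rw [mul_right_cancel hji, hα.eq]
    have := cs.length_wordProd_le (α.eraseIdx j)
    rw [List.length_eraseIdx_of_lt hjα] at this
    omega
  · right
    rw [List.eraseIdx_append_of_length_le hjα, cs.wordProd_append] at hji
    refine ⟨_, hji, ?_⟩
    rw [hβ.eq]
    have hj' : j - α.length < β.length := by rw [List.length_append] at hj; omega
    have := cs.length_wordProd_le (β.eraseIdx (j - α.length))
    rw [List.length_eraseIdx_of_lt hj'] at this
    omega

variable {cs}

theorem inv_of_mem_simpleSet {s : W} (hs : s ∈ simpleSet cs) : s⁻¹ = s := by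
  obtain ⟨i, rfl⟩ := hs
  exact cs.inv_simple i

theorem mul_mul_of_mem_simpleSet {s : W} (hs : s ∈ simpleSet cs) (w : W) : s * (s * w) = w := by
  obtain ⟨i, rfl⟩ := hs
  exact cs.simple_mul_simple_cancel_left i

theorem length_of_mem_simpleSet {s : W} (hs : s ∈ simpleSet cs) : cs.length s = 1 := by
  obtain ⟨i, rfl⟩ := hs
  exact cs.length_simple i

theorem length_mul_of_mem_simpleSet {s : W} (hs : s ∈ simpleSet cs) (w : W) :
    cs.length (s * w) = cs.length w + 1 ∨ cs.length (s * w) + 1 = cs.length w := by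
  obtain ⟨i, rfl⟩ := hs
  exact cs.length_simple_mul w i

section Parabolic

variable {I : Set W}

theorem mem_par_of_mem {s : W} (hs : s ∈ I) : s ∈ par I := Subgroup.subset_closure hs

theorem par_mono {J : Set W} (h : I ⊆ J) : par I ≤ par J := Subgroup.closure_mono h

/-- Every element of `W_I` has a reduced word with letters in `I`. -/
theorem exists_isReduced_of_mem_par (hI : I ⊆ simpleSet cs) {u : W} (hu : u ∈ par I) :
    ∃ ω : List B, cs.IsReduced ω ∧ u = cs.wordProd ω ∧ ∀ i ∈ ω, cs.simple i ∈ I := by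
  have step : ∀ s ∈ I, ∀ u : W,
      (∃ ω : List B, cs.IsReduced ω ∧ u = cs.wordProd ω ∧ ∀ i ∈ ω, cs.simple i ∈ I) →
      ∃ ω : List B, cs.IsReduced ω ∧ s * u = cs.wordProd ω ∧ ∀ i ∈ ω, cs.simple i ∈ I := by
    rintro s hs _ ⟨ω, hω, rfl, hmem⟩
    obtain ⟨i, rfl⟩ := hI hs
    rcases cs.length_simple_mul (cs.wordProd ω) i with h | h
    · refine ⟨i :: ω, ?_, (cs.wordProd_cons i ω).symm, ?_⟩
      · rw [CoxeterSystem.IsReduced, cs.wordProd_cons, h, hω.eq, List.length_cons]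
      · simpa using ⟨hs, hmem⟩
    · obtain ⟨j, hj, hji⟩ := exists_simple_mul_eq_eraseIdx cs (ω := ω) (i := i) (by omega)
      refine ⟨ω.eraseIdx j, ?_, hji, fun k hk => hmem k (List.mem_of_mem_eraseIdx hk)⟩
      have hlen := List.length_eraseIdx_of_lt hj
      rw [CoxeterSystem.IsReduced, ← hji, hlen]
      rw [hω.eq] at h
      omega
  induction hu using Subgroup.closure_induction_left with
  | one => exact ⟨[], by simp [CoxeterSystem.IsReduced], by simp, by simp⟩
  | mul_left s hs u hu ih => exact step s hs u ih
  | inv_mul_cancel s hs u hu ih =>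
    rw [inv_of_mem_simpleSet (hI hs)]
    exact step s hs u ih

theorem exists_descent_of_mem_par (hI : I ⊆ simpleSet cs) {u : W} (hu : u ∈ par I)
    (hu1 : u ≠ 1) : ∃ s ∈ I, cs.length (s * u) < cs.length u := by
  obtain ⟨ω, hω, rfl, hmem⟩ := exists_isReduced_of_mem_par hI hu
  cases ω with
  | nil => simp at hu1
  | cons i ω =>
    refine ⟨cs.simple i, hmem i (by simp), ?_⟩
    rw [hω.eq, cs.wordProd_cons, cs.simple_mul_simple_cancel_left, List.length_cons]
    have := cs.length_wordProd_le ω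
    omega

variable (cs I) in
/-- `b` has no left descent in `I`. -/
def LeftReduced (b : W) : Prop := ∀ s ∈ I, cs.length b < cs.length (s * b)

theorem LeftReduced.mono {J : Set W} (h : I ⊆ J) {b : W} (hb : LeftReduced cs J b) :
    LeftReduced cs I b := fun s hs => hb s (h hs)

theorem length_mul_of_minimal (hI : I ⊆ simpleSet cs) {b : W}
    (hb : ∀ u ∈ par I, cs.length b ≤ cs.length (u * b)) {u : W} (hu : u ∈ par I) :
    cs.length (u * b) = cs.length u + cs.length b := by
  have step : ∀ s ∈ I, ∀ u ∈ par I, cs.length (u * b) = cs.length u + cs.length b →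
      cs.length (s * u * b) = cs.length (s * u) + cs.length b := by
    intro s hs u hu ih
    rw [mul_assoc]
    have hle := cs.length_mul_le (s * u) b
    rw [mul_assoc] at hle
    have h1 := length_mul_of_mem_simpleSet (hI hs) u
    have h2 := length_mul_of_mem_simpleSet (hI hs) (u * b)
    by_cases hlt : cs.length (s * (u * b)) < cs.length (u * b)
    · rcases exchange_mul cs (hI hs) hlt with h | ⟨b', hb', hlt'⟩
      · omega
      · have := hb (u⁻¹ * s * u)
          (mul_mem (mul_mem (inv_mem hu) (mem_par_of_mem hs)) hu)
        rw [show u⁻¹ * s * u * b = b' by rw [mul_assoc, mul_assoc, hb']; simp] at this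
        omega
    · omega
  induction hu using Subgroup.closure_induction_left with
  | one => simp
  | mul_left s hs u hu ih => exact step s hs u hu ih
  | inv_mul_cancel s hs u hu ih =>
    rw [inv_of_mem_simpleSet (hI hs)]
    exact step s hs u hu ih

theorem exists_minimal_mul (I : Set W) (w : W) :
    ∃ u ∈ par I, ∃ b, w = u * b ∧ ∀ v ∈ par I, cs.length b ≤ cs.length (v * b) := by
  obtain ⟨v, hv, hmin⟩ := (measure fun v => cs.length (v * w)).wf.has_min
    (par I : Set W) ⟨1, one_mem _⟩
  refine ⟨v⁻¹, inv_mem hv, v * w, by simp, fun x hx => ?_⟩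
  have := hmin (x * v) (mul_mem hx hv)
  simpa [measure, WellFoundedRelation.rel, InvImage, mul_assoc] using this

theorem LeftReduced.length_mul (hI : I ⊆ simpleSet cs) {b : W} (hb : LeftReduced cs I b)
    {u : W} (hu : u ∈ par I) : cs.length (u * b) = cs.length u + cs.length b := by
  obtain ⟨v, hv, c, rfl, hc⟩ := exists_minimal_mul (cs := cs) I b
  have hv1 : v = 1 := by
    by_contra hne
    obtain ⟨s, hs, hlt⟩ := exists_descent_of_mem_par hI hv hne
    have h := hb s hs
    rw [← mul_assoc, length_mul_of_minimal hI hc hv,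
      length_mul_of_minimal hI hc (mul_mem (mem_par_of_mem hs) hv)] at h
    omega
  subst hv1
  rw [one_mul]
  exact length_mul_of_minimal hI hc hu

theorem exists_leftReduced_mul (hI : I ⊆ simpleSet cs) (w : W) :
    ∃ u ∈ par I, ∃ b, w = u * b ∧ LeftReduced cs I b := by
  obtain ⟨u, hu, b, rfl, hb⟩ := exists_minimal_mul (cs := cs) I w
  refine ⟨u, hu, b, rfl, fun s hs => ?_⟩
  rw [length_mul_of_minimal hI hb (mem_par_of_mem hs), length_of_mem_simpleSet (hI hs)]
  omega

/-- Minimal representatives of a coset of `W_I` are unique. -/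
theorem LeftReduced.eq_of_eq_mul (hI : I ⊆ simpleSet cs) {b c u : W}
    (hb : LeftReduced cs I b) (hc : LeftReduced cs I c) (hu : u ∈ par I) (h : b = u * c) :
    b = c := by
  have h1 := hc.length_mul hI hu
  have h2 := hb.length_mul hI (inv_mem hu)
  rw [h, inv_mul_cancel_left, cs.length_inv, h1] at h2
  rw [h, cs.length_eq_zero_iff.1 (show cs.length u = 0 by omega), one_mul]

/-- Deodhar's lemma. -/
theorem LeftReduced.mul_simple (hI : I ⊆ simpleSet cs) {b s : W} (hb : LeftReduced cs I b)
    (hs : s ∈ simpleSet cs) : LeftReduced cs I (b * s) ∨ ∃ t ∈ I, b * s = t * b := by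
  by_contra! hcon
  obtain ⟨hnot, hne⟩ := hcon
  simp only [LeftReduced, not_forall, not_lt] at hnot
  obtain ⟨t, ht, hle⟩ := hnot
  have h1 := length_mul_of_mem_simpleSet (hI ht) (b * s)
  have h2 := hb t ht
  have hs1 := length_of_mem_simpleSet hs
  have h3 := cs.length_le_length_mul_add_right (t * b) s
  have h4 := cs.length_mul_le b s
  have h5 := length_mul_of_mem_simpleSet (hI ht) b
  rw [mul_assoc] at h3
  rcases exchange_mul cs (a := b) (b := s) (hI ht) (by omega) with h | ⟨b', hb', hlt⟩
  · omega
  · rw [cs.length_eq_zero_iff.1 (show cs.length b' = 0 by omega), mul_one] at hb'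
    refine hne t ht ?_
    rw [← hb', mul_mul_of_mem_simpleSet (hI ht), hb']

/-- Minimal representatives of a double coset `W_I \ W / W_J` are unique. -/
theorem LeftReduced.eq_of_eq_mul_mul {J : Set W} (hI : I ⊆ simpleSet cs)
    (hJ : J ⊆ simpleSet cs) {p v a b : W} (hp : LeftReduced cs I p)
    (hp' : LeftReduced cs J p⁻¹) (hv : LeftReduced cs I v) (hv' : LeftReduced cs J v⁻¹)
    (ha : a ∈ par I) (hb : b ∈ par J) (h : p = a * v * b) : p = v := by
  have key : ∀ b ∈ par J, ∃ x ∈ par I, ∃ y ∈ par J,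
      v * b⁻¹ = x * (v * y) ∧ LeftReduced cs I (v * y) := by
    have step : ∀ s ∈ J, ∀ b ∈ par J, (∃ x ∈ par I, ∃ y ∈ par J,
        v * b⁻¹ = x * (v * y) ∧ LeftReduced cs I (v * y)) → ∃ x ∈ par I, ∃ y ∈ par J,
        v * (s * b)⁻¹ = x * (v * y) ∧ LeftReduced cs I (v * y) := by
      rintro s hs b - ⟨x, hx, y, hy, hxy, hred⟩
      rw [mul_inv_rev, ← mul_assoc, hxy, inv_of_mem_simpleSet (hJ hs)]
      rcases hred.mul_simple hI (hJ hs) with h | ⟨t, ht, h⟩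
      · exact ⟨x, hx, y * s, mul_mem hy (mem_par_of_mem hs), by simp only [mul_assoc],
          by rwa [← mul_assoc]⟩
      · exact ⟨x * t, mul_mem hx (mem_par_of_mem ht), y, hy, by
          rw [mul_assoc x t, ← h, mul_assoc], hred⟩
    intro b hb
    induction hb using Subgroup.closure_induction_left with
    | one => exact ⟨1, one_mem _, 1, one_mem _, by simp, by simpa using hv⟩
    | mul_left s hs b hb ih => exact step s hs b hb ih
    | inv_mul_cancel s hs b hb ih =>
      rw [inv_of_mem_simpleSet (hJ hs)]
      exact step s hs b hb ih
  obtain ⟨x, hx, y, hy, hxy, hred⟩ := key b⁻¹ (inv_mem hb)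
  rw [inv_inv] at hxy
  have hpy : p = v * y := hp.eq_of_eq_mul hI hred (mul_mem ha hx) (by
    rw [h, mul_assoc, hxy, mul_assoc])
  exact inv_injective (hp'.eq_of_eq_mul hJ hv' (inv_mem hy) (by rw [hpy, mul_inv_rev]))

end Parabolic

section Longest

variable {I : Set W}

theorem IsLongest.length_mul_lt (hI : I ⊆ simpleSet cs) {u : W} (hu : IsLongest cs I u) {s : W}
    (hs : s ∈ I) : cs.length (s * u) < cs.length u := by
  have h1 := hu.2 (s * u) (mul_mem (mem_par_of_mem hs) hu.1)
  have h2 := length_mul_of_mem_simpleSet (hI hs) u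
  omega

theorem length_add_of_descents (hI : I ⊆ simpleSet cs) {u : W}
    (hdesc : ∀ s ∈ I, cs.length (s * u) < cs.length u) {v : W} (hv : v ∈ par I) :
    cs.length (v⁻¹ * u) + cs.length v = cs.length u := by
  induction hn : cs.length v generalizing v with
  | zero =>
    rw [cs.length_eq_zero_iff.1 hn]
    simp
  | succ n ih =>
    have hv1 : v ≠ 1 := by
      rintro rfl
      simp at hn
    obtain ⟨s, hs, hlt⟩ := exists_descent_of_mem_par hI hv hv1
    have hlen := length_mul_of_mem_simpleSet (hI hs) v
    have ih' := ih (mul_mem (mem_par_of_mem hs) hv) (by omega)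
    set v' := s * v with hv'
    have hvs : v = s * v' := (mul_mul_of_mem_simpleSet (hI hs) v).symm
    have hprod : v' * (v'⁻¹ * u) = u := mul_inv_cancel_left v' u
    rcases exchange_mul cs (a := v') (b := v'⁻¹ * u) (hI hs)
      (by rw [hprod]; exact hdesc s hs) with h | ⟨z, hz, hzlt⟩
    · rw [← hvs] at h
      omega
    · rw [hprod] at hz
      have hvu : v⁻¹ * u = z := by
        rw [inv_mul_eq_iff_eq_mul, hvs, mul_assoc, ← hz, mul_mul_of_mem_simpleSet (hI hs)]
      have := cs.length_le_length_mul_add_left v⁻¹ u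
      rw [cs.length_inv] at this
      rw [hvu] at this ⊢
      omega

theorem IsLongest.length_inv_mul (hI : I ⊆ simpleSet cs) {u : W} (hu : IsLongest cs I u) {v : W}
    (hv : v ∈ par I) : cs.length (v⁻¹ * u) + cs.length v = cs.length u :=
  length_add_of_descents hI (fun _ hs => hu.length_mul_lt hI hs) hv

theorem IsLongest.length_mul (hI : I ⊆ simpleSet cs) {u : W} (hu : IsLongest cs I u) {v : W}
    (hv : v ∈ par I) : cs.length (v * u) + cs.length v = cs.length u := by
  simpa using hu.length_inv_mul hI (inv_mem hv)

theorem isLongest_of_descents (hI : I ⊆ simpleSet cs) {u : W} (hu : u ∈ par I)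
    (hdesc : ∀ s ∈ I, cs.length (s * u) < cs.length u) : IsLongest cs I u :=
  ⟨hu, fun v hv => by have := length_add_of_descents hI hdesc hv; omega⟩

theorem IsLongest.eq_of_length_le (hI : I ⊆ simpleSet cs) {u v : W} (hu : IsLongest cs I u)
    (hv : v ∈ par I) (hle : cs.length u ≤ cs.length v) : u = v := by
  have h := hu.length_inv_mul hI hv
  have : v⁻¹ * u = 1 := cs.length_eq_zero_iff.1 (by omega)
  rw [inv_mul_eq_one] at this
  exact this.symm

theorem IsLongest.inv_eq (hI : I ⊆ simpleSet cs) {u : W} (hu : IsLongest cs I u) : u⁻¹ = u :=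
  (hu.eq_of_length_le hI (inv_mem hu.1) (cs.length_inv u).ge).symm

theorem IsLongest.length_conj (hI : I ⊆ simpleSet cs) {u : W} (hu : IsLongest cs I u) {v : W}
    (hv : v ∈ par I) : cs.length (u * v * u⁻¹) = cs.length v := by
  have h1 := hu.length_mul hI (mul_mem hu.1 hv)
  have h2 := hu.length_inv_mul hI hv
  have h3 : cs.length (u * v) = cs.length (v⁻¹ * u) := by
    rw [← cs.length_inv, mul_inv_rev, hu.inv_eq hI]
  rw [hu.inv_eq hI]
  omega

theorem exists_isLongest (hfin : (par I : Set W).Finite) : ∃ u, IsLongest cs I u := by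
  obtain ⟨u, hu, hmax⟩ := Set.exists_max_image _ cs.length hfin ⟨1, one_mem _⟩
  exact ⟨u, hu, hmax⟩

theorem isLongest_longest (hfin : (par I : Set W).Finite) : IsLongest cs I (longest cs I) := by
  have h := exists_isLongest (cs := cs) hfin
  rw [longest, dif_pos h]
  exact h.choose_spec

theorem finite_par_of_isLongest (hI : I ⊆ simpleSet cs) (hfin : I.Finite) {u : W}
    (hu : IsLongest cs I u) : (par I : Set W).Finite := by
  have : Finite I := hfin
  refine ((List.finite_length_le I (cs.length u)).image
    fun l => (l.map Subtype.val).prod).subset fun v hv => ?_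
  obtain ⟨ω, hω, rfl, hmem⟩ := exists_isReduced_of_mem_par hI hv
  have hmem' : ∀ x ∈ ω.map cs.simple, x ∈ I := by simpa using hmem
  obtain ⟨l, hl⟩ := CanLift.prf (β := List I) (ω.map cs.simple) hmem'
  change l.map Subtype.val = _ at hl
  refine ⟨l, ?_, by simp only [hl, CoxeterSystem.wordProd]⟩
  have hlen := congrArg List.length hl
  rw [List.length_map, List.length_map] at hlen
  have := hu.2 _ hv
  rw [hω.eq] at this
  change l.length ≤ _
  omega

/-- An element with all of `I` as left descents is divisible on the left by the longest element
of `W_I`. -/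
theorem exists_isLongest_mul_of_descents (hI : I ⊆ simpleSet cs) {x : W}
    (hdesc : ∀ s ∈ I, cs.length (s * x) < cs.length x) :
    ∃ u b, IsLongest cs I u ∧ LeftReduced cs I b ∧ x = u * b := by
  obtain ⟨u, hu, b, rfl, hb⟩ := exists_leftReduced_mul hI x
  refine ⟨u, b, isLongest_of_descents hI hu fun s hs => ?_, hb, rfl⟩
  have h := hdesc s hs
  rw [← mul_assoc, hb.length_mul hI hu,
    hb.length_mul hI (mul_mem (mem_par_of_mem hs) hu)] at h
  omega

end Longest

section Relative

variable {Sg : Set W}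

theorem image_conj_eq_iff {w : W} :
    (fun u => w * u * w⁻¹) '' (par Sg : Set W) = (par Sg : Set W) ↔
      w ∈ Subgroup.normalizer (par Sg : Set W) := by
  rw [Subgroup.mem_set_normalizer_iff]
  constructor
  · intro h n
    constructor
    · intro hn
      rw [← h]
      exact ⟨n, hn, rfl⟩
    · intro hn
      rw [← h] at hn
      obtain ⟨m, hm, hmn⟩ := hn
      simpa using (mul_left_cancel (mul_right_cancel hmn)) ▸ hm
  · intro h
    ext x
    constructor
    · rintro ⟨n, hn, rfl⟩
      exact (h n).1 hn
    · intro hx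
      refine ⟨w⁻¹ * x * w, (h _).2 ?_, by simp [mul_assoc]⟩
      simpa [mul_assoc] using hx

theorem mem_relW_iff (hS : Sg ⊆ simpleSet cs) {w : W} :
    w ∈ relW cs Sg ↔ w ∈ Subgroup.normalizer (par Sg : Set W) ∧ LeftReduced cs Sg w := by
  rw [relW, Set.mem_ofPred_eq, image_conj_eq_iff]
  refine and_congr_right fun _ => ⟨fun h s hs => ?_, fun h => ?_⟩
  · by_contra hlt
    have hlen := length_mul_of_mem_simpleSet (hS hs) w
    have hmem : s ∈ invSet cs w ∩ parRefl Sg := by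
      refine ⟨⟨?_, by omega⟩, 1, one_mem _, s, hs, by simp⟩
      obtain ⟨i, rfl⟩ := hS hs
      exact cs.isReflection_simple i
    rw [h] at hmem
    exact hmem
  · rw [Set.eq_empty_iff_forall_notMem]
    rintro t ⟨⟨-, hlt⟩, u, hu, s, hs, rfl⟩
    rw [h.length_mul hS (mul_mem (mul_mem hu (mem_par_of_mem hs)) (inv_mem hu))] at hlt
    omega

theorem one_mem_relW (hS : Sg ⊆ simpleSet cs) : (1 : W) ∈ relW cs Sg := by
  rw [mem_relW_iff hS]
  refine ⟨one_mem _, fun s hs => ?_⟩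
  rw [mul_one, length_of_mem_simpleSet (hS hs), cs.length_one]
  exact one_pos

theorem inv_mem_relW (hS : Sg ⊆ simpleSet cs) {w : W} (hw : w ∈ relW cs Sg) :
    w⁻¹ ∈ relW cs Sg := by
  rw [mem_relW_iff hS] at hw ⊢
  refine ⟨inv_mem hw.1, fun s hs => ?_⟩
  have hmem := (Subgroup.mem_set_normalizer_iff.1 hw.1 s).1 (mem_par_of_mem hs)
  have hlen := hw.2.length_mul hS hmem
  have hne : cs.length (w * s * w⁻¹) ≠ 0 := by
    rw [Ne, cs.length_eq_zero_iff, mul_inv_eq_one, mul_eq_left]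
    rintro rfl
    simpa using length_of_mem_simpleSet (hS hs)
  rw [inv_mul_cancel_right] at hlen
  rw [← cs.length_inv (s * w⁻¹), mul_inv_rev, inv_inv, inv_of_mem_simpleSet (hS hs), hlen,
    cs.length_inv]
  omega

theorem union_singleton_subset_simpleSet (hSg : GoodSubset cs Sg) {s : W} (hs : s ∈ complSet cs Sg)
    : Sg ∪ {s} ⊆ simpleSet cs :=
  Set.union_subset hSg.1 (Set.singleton_subset_iff.2 hs.1.1)

theorem longest_union_mem_normalizer (hSg : GoodSubset cs Sg) {s : W} (hs : s ∈ complSet cs Sg) :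
    longest cs (Sg ∪ {s}) ∈ Subgroup.normalizer (par Sg : Set W) :=
  image_conj_eq_iff.1 (hSg.2.2 _ Set.subset_union_left
    (union_singleton_subset_simpleSet hSg hs) hs.2 _ (isLongest_longest hs.2))

theorem tilde_eq_longest_mul_longest (hSg : GoodSubset cs Sg) {s : W} (hs : s ∈ complSet cs Sg) :
    tilde cs Sg s = longest cs Sg * longest cs (Sg ∪ {s}) := by
  have hI := union_singleton_subset_simpleSet hSg hs
  have h0 := isLongest_longest (cs := cs) hSg.2.1
  have h1 := isLongest_longest (cs := cs) hs.2
  have hconj := (Subgroup.mem_set_normalizer_iff.1 (longest_union_mem_normalizer hSg hs) _).1 h0.1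
  have hlen := h1.length_conj hI (par_mono Set.subset_union_left h0.1)
  have := h0.eq_of_length_le hSg.1 hconj hlen.ge
  rw [eq_mul_inv_iff_mul_eq] at this
  exact this.symm

theorem tilde_inv (hSg : GoodSubset cs Sg) {s : W} (hs : s ∈ complSet cs Sg)
    : (tilde cs Sg s)⁻¹ = tilde cs Sg s := by
  conv_rhs => rw [tilde_eq_longest_mul_longest hSg hs]
  rw [tilde, mul_inv_rev, (isLongest_longest hSg.2.1).inv_eq hSg.1,
    (isLongest_longest hs.2).inv_eq (union_singleton_subset_simpleSet hSg hs)]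

theorem tilde_mem_par (hSg : GoodSubset cs Sg) {s : W} (hs : s ∈ complSet cs Sg)
    : tilde cs Sg s ∈ par (Sg ∪ {s}) :=
  mul_mem (isLongest_longest (cs := cs) hs.2).1
    (par_mono Set.subset_union_left (isLongest_longest (cs := cs) hSg.2.1).1)

theorem length_tilde_add (hSg : GoodSubset cs Sg) {s : W} (hs : s ∈ complSet cs Sg)
    : cs.length (tilde cs Sg s) + cs.length (longest cs Sg) =
    cs.length (longest cs (Sg ∪ {s})) := by
  rw [tilde_eq_longest_mul_longest hSg hs]
  exact (isLongest_longest hs.2).length_mul (union_singleton_subset_simpleSet hSg hs)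
    (par_mono Set.subset_union_left (isLongest_longest hSg.2.1).1)

theorem length_tilde_pos (hSg : GoodSubset cs Sg) {s : W} (hs : s ∈ complSet cs Sg)
    : 0 < cs.length (tilde cs Sg s) := by
  rw [Nat.pos_iff_ne_zero, Ne, cs.length_eq_zero_iff, tilde,
    mul_eq_one_iff_eq_inv, (isLongest_longest (cs := cs) hSg.2.1).inv_eq hSg.1]
  intro h
  have hred : LeftReduced cs Sg s := by
    intro t ht
    have hlen := length_mul_of_mem_simpleSet (hSg.1 ht) s
    have hs1 := length_of_mem_simpleSet hs.1.1
    have hne : cs.length (t * s) ≠ 0 := by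
      rw [Ne, cs.length_eq_zero_iff, mul_eq_one_iff_inv_eq, inv_of_mem_simpleSet (hSg.1 ht)]
      rintro rfl
      exact hs.1.2 ht
    omega
  have h0 := (isLongest_longest (cs := cs) hSg.2.1).1
  have hadd := hred.length_mul hSg.1 h0
  have hle := (isLongest_longest (cs := cs) hs.2).2 (longest cs Sg * s)
    (mul_mem (par_mono Set.subset_union_left h0) (mem_par_of_mem (Or.inr rfl)))
  rw [h, hadd, length_of_mem_simpleSet hs.1.1] at hle
  omega

theorem leftReduced_tilde_mul_of_leftReduced (hSg : GoodSubset cs Sg) {s : W}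
    (hs : s ∈ complSet cs Sg) {w : W} (hw : LeftReduced cs (Sg ∪ {s}) w) :
    LeftReduced cs Sg (tilde cs Sg s * w) := by
  have hI := union_singleton_subset_simpleSet hSg hs
  intro t ht
  have htI : t ∈ par (Sg ∪ {s}) := mem_par_of_mem (Or.inl ht)
  have h0 := isLongest_longest (cs := cs) hSg.2.1
  have h1 := isLongest_longest (cs := cs) hs.2
  have hmem := tilde_mem_par hSg hs
  have hle := h1.length_mul hI (par_mono Set.subset_union_left
    (mul_mem (mem_par_of_mem ht) h0.1))
  have hlt := h0.length_mul_lt hSg.1 ht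
  have hadd := length_tilde_add hSg hs
  rw [mul_assoc, ← tilde_eq_longest_mul_longest hSg hs] at hle
  rw [← mul_assoc, hw.length_mul hI hmem, hw.length_mul hI (mul_mem htI hmem)]
  omega

theorem tilde_mem_normalizer (hSg : GoodSubset cs Sg) {s : W} (hs : s ∈ complSet cs Sg)
    : tilde cs Sg s ∈ Subgroup.normalizer (par Sg : Set W) :=
  mul_mem (longest_union_mem_normalizer hSg hs)
    (Subgroup.le_normalizer (isLongest_longest (cs := cs) hSg.2.1).1)

theorem leftReduced_union_singleton (hS : Sg ⊆ simpleSet cs) {s w : W} (hs : s ∈ simpleSet cs)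
    (hw : w ∈ relW cs Sg) (hsw : ¬ cs.length (s * w) < cs.length w) :
    LeftReduced cs (Sg ∪ {s}) w := by
  rintro t (ht | rfl)
  · exact ((mem_relW_iff hS).1 hw).2 t ht
  · have := length_mul_of_mem_simpleSet hs w
    omega

/-- If `s` is a left descent of `w ∈ W̃`, then `s̃` is defined and divides `w` on the left. -/
theorem tilde_mul_of_descent (hSg : GoodSubset cs Sg) {s w : W} (hs : s ∈ simpleSet cs)
    (hw : w ∈ relW cs Sg) (hsw : cs.length (s * w) < cs.length w) :
    s ∈ complSet cs Sg ∧ tilde cs Sg s * w ∈ relW cs Sg ∧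
      cs.length (tilde cs Sg s * w) + cs.length (tilde cs Sg s) = cs.length w := by
  obtain ⟨hnorm, hred⟩ := (mem_relW_iff hSg.1).1 hw
  have hI : Sg ∪ {s} ⊆ simpleSet cs :=
    Set.union_subset hSg.1 (Set.singleton_subset_iff.2 hs)
  have h0 := isLongest_longest (cs := cs) hSg.2.1
  set w0 := longest cs Sg with hw0
  have hx : cs.length (w0 * w) = cs.length w0 + cs.length w := hred.length_mul hSg.1 h0.1
  set v := w⁻¹ * w0 * w with hv
  have hvmem : v ∈ par Sg := (Subgroup.mem_set_normalizer_iff''.1 hnorm w0).1 h0.1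
  have hwv : w0 * w = w * v := by simp [hv, mul_assoc]
  have hdesc : ∀ t ∈ Sg ∪ {s}, cs.length (t * (w0 * w)) < cs.length (w0 * w) := by
    rintro t (ht | rfl)
    · rw [← mul_assoc, hred.length_mul hSg.1 (mul_mem (mem_par_of_mem ht) h0.1), hx]
      have := h0.length_mul_lt hSg.1 ht
      omega
    · have h1 := cs.length_mul_le (t * w) v
      have h2 := h0.2 v hvmem
      rw [mul_assoc, ← hwv] at h1
      omega
  obtain ⟨u, b, hu, hb, hub⟩ := exists_isLongest_mul_of_descents hI hdesc
  have hfin : (Sg ∪ {s}).Finite :=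
    (hSg.2.1.subset Subgroup.subset_closure).union (Set.finite_singleton s)
  have hs' : s ∈ complSet cs Sg :=
    ⟨⟨hs, fun h => (hred s h).not_gt hsw⟩, finite_par_of_isLongest hI hfin hu⟩
  have h1 := isLongest_longest (cs := cs) hs'.2
  have hu1 : u = longest cs (Sg ∪ {s}) := hu.eq_of_length_le hI h1.1 (h1.2 u hu.1)
  have hbw : tilde cs Sg s * w = b := by
    rw [tilde, mul_assoc, ← hw0, hub, hu1, ← mul_assoc]
    nth_rw 1 [← h1.inv_eq hI]
    simp
  have hlen := hb.length_mul hI hu.1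
  have hadd := length_tilde_add hSg hs'
  rw [← hub, hx, hu1] at hlen
  rw [← hw0] at hadd
  refine ⟨hs', ?_, by rw [hbw]; omega⟩
  rw [mem_relW_iff hSg.1]
  exact ⟨mul_mem (tilde_mem_normalizer hSg hs') hnorm, hbw ▸ hb.mono Set.subset_union_left⟩

theorem tilde_mul_of_not_descent (hSg : GoodSubset cs Sg) {s w : W} (hs : s ∈ complSet cs Sg)
    (hw : w ∈ relW cs Sg) (hsw : ¬ cs.length (s * w) < cs.length w) :
    tilde cs Sg s * w ∈ relW cs Sg ∧
      cs.length (tilde cs Sg s * w) = cs.length (tilde cs Sg s) + cs.length w := by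
  have hred := leftReduced_union_singleton hSg.1 hs.1.1 hw hsw
  refine ⟨?_, hred.length_mul (union_singleton_subset_simpleSet hSg hs) (tilde_mem_par hSg hs)⟩
  rw [mem_relW_iff hSg.1] at hw ⊢
  exact ⟨mul_mem (tilde_mem_normalizer hSg hs) hw.1,
    leftReduced_tilde_mul_of_leftReduced hSg hs hred⟩

theorem length_pos_of_mem_relS (hSg : GoodSubset cs Sg) {r : W} (hr : r ∈ relS cs Sg)
    : 0 < cs.length r := by
  obtain ⟨s, hs, rfl⟩ := hr
  exact length_tilde_pos hSg hs

theorem inv_of_mem_relS (hSg : GoodSubset cs Sg) {r : W} (hr : r ∈ relS cs Sg) : r⁻¹ = r := by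
  obtain ⟨s, hs, rfl⟩ := hr
  exact tilde_inv hSg hs

theorem mul_self_of_mem_relS (hSg : GoodSubset cs Sg) {r : W} (hr : r ∈ relS cs Sg)
    : r * r = 1 := by
  nth_rw 1 [← inv_of_mem_relS hSg hr]
  exact inv_mul_cancel r

theorem mul_mem_relW_of_mem_relS (hSg : GoodSubset cs Sg) {r : W} (hr : r ∈ relS cs Sg)
    {w : W} (hw : w ∈ relW cs Sg) : r * w ∈ relW cs Sg := by
  obtain ⟨s, hs, rfl⟩ := hr
  by_cases hsw : cs.length (s * w) < cs.length w
  · exact (tilde_mul_of_descent hSg hs.1.1 hw hsw).2.1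
  · exact (tilde_mul_of_not_descent hSg hs hw hsw).1

theorem length_mul_of_mem_relS (hSg : GoodSubset cs Sg) {r : W} (hr : r ∈ relS cs Sg)
    {w : W} (hw : w ∈ relW cs Sg) :
    cs.length (r * w) = cs.length r + cs.length w ∨
      cs.length (r * w) + cs.length r = cs.length w := by
  obtain ⟨s, hs, rfl⟩ := hr
  by_cases hsw : cs.length (s * w) < cs.length w
  · exact Or.inr (tilde_mul_of_descent hSg hs.1.1 hw hsw).2.2
  · exact Or.inl (tilde_mul_of_not_descent hSg hs hw hsw).2

theorem exists_relS_descent (hSg : GoodSubset cs Sg) {w : W} (hw : w ∈ relW cs Sg)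
    (hw1 : w ≠ 1) : ∃ r ∈ relS cs Sg, cs.length (r * w) + cs.length r = cs.length w := by
  obtain ⟨i, hi⟩ := cs.exists_leftDescent_of_ne_one hw1
  obtain ⟨hs, -, hlen⟩ := tilde_mul_of_descent hSg (Set.mem_range_self i) hw hi
  exact ⟨_, ⟨_, hs, rfl⟩, hlen⟩

/-- The key exchange step: if `r p` and `p r'` are length-additive but `r` shortens `p r'`, then
`r p = p r'`. -/
theorem relS_mul_eq_mul_relS (hSg : GoodSubset cs Sg) {p r r' : W} (hr : r ∈ relS cs Sg)
    (hr' : r' ∈ relS cs Sg) (hp : p ∈ relW cs Sg)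
    (h1 : cs.length (r * p) = cs.length r + cs.length p)
    (h2 : cs.length (p * r') = cs.length p + cs.length r')
    (h3 : cs.length (r * (p * r')) + cs.length r = cs.length (p * r')) : r * p = p * r' := by
  have hrr := mul_self_of_mem_relS hSg hr
  have hrr' := mul_self_of_mem_relS hSg hr'
  have hrinv := inv_of_mem_relS hSg hr
  have hrinv' := inv_of_mem_relS hSg hr'
  have hpos := length_pos_of_mem_relS hSg hr
  have hpos' := length_pos_of_mem_relS hSg hr'
  have reduced : ∀ {s q : W}, s ∈ complSet cs Sg → q ∈ relW cs Sg →
      cs.length (tilde cs Sg s * q) = cs.length (tilde cs Sg s) + cs.length q →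
      LeftReduced cs (Sg ∪ {s}) q := by
    intro s q hs hq hlen
    refine leftReduced_union_singleton hSg.1 hs.1.1 hq fun hlt => ?_
    have := (tilde_mul_of_descent hSg hs.1.1 hq hlt).2.2
    have := length_tilde_pos hSg hs
    omega
  have hp' := inv_mem_relW hSg.1 hp
  have hrp := mul_mem_relW_of_mem_relS hSg hr hp
  have hv' : (r * p * r')⁻¹ ∈ relW cs Sg := by
    rw [mul_inv_rev, hrinv']
    exact mul_mem_relW_of_mem_relS hSg hr' (inv_mem_relW hSg.1 hrp)
  have hv : r * p * r' ∈ relW cs Sg := by simpa using inv_mem_relW hSg.1 hv'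
  have h4 := length_mul_of_mem_relS hSg hr' (inv_mem_relW hSg.1 hrp)
  have h5 : cs.length (r' * (r * p)⁻¹) = cs.length (r * p * r') := by
    rw [← cs.length_inv, mul_inv_rev, inv_inv, hrinv']
  have h6 : cs.length (r' * p⁻¹) = cs.length (p * r') := by
    rw [← cs.length_inv, mul_inv_rev, inv_inv, hrinv']
  rw [h5, cs.length_inv] at h4
  rw [← mul_assoc] at h3
  have h7 : r * (r * p * r') = p * r' := by rw [← mul_assoc, ← mul_assoc, hrr, one_mul]
  have h8 : r' * (r * p * r')⁻¹ = (r * p)⁻¹ := by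
    rw [mul_inv_rev, hrinv', ← mul_assoc, hrr', one_mul]
  obtain ⟨s, hs, rfl⟩ := hr
  obtain ⟨s', hs', rfl⟩ := hr'
  have key : p = tilde cs Sg s * p * tilde cs Sg s' :=
    LeftReduced.eq_of_eq_mul_mul (union_singleton_subset_simpleSet hSg hs)
      (union_singleton_subset_simpleSet hSg hs')
      (reduced hs hp h1)
      (reduced hs' hp' (by rw [h6, cs.length_inv]; omega))
      (reduced hs hv (by rw [h7]; omega))
      (reduced hs' hv' (by rw [h8, cs.length_inv, cs.length_inv]; omega))
      (tilde_mem_par hSg hs) (tilde_mem_par hSg hs') (by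
        rw [mul_assoc, mul_assoc, hrr', mul_one, ← mul_assoc, hrr, one_mul])
  nth_rw 2 [key]
  rw [mul_assoc _ _ (tilde cs Sg s'), hrr', mul_one]

section Words

theorem prod_mul_mem_relW (hSg : GoodSubset cs Sg) {l : List W} (hl : ∀ x ∈ l, x ∈ relS cs Sg)
    {w : W} (hw : w ∈ relW cs Sg) : l.prod * w ∈ relW cs Sg := by
  induction l with
  | nil => simpa
  | cons r l ih =>
    rw [List.forall_mem_cons] at hl
    rw [List.prod_cons, mul_assoc]
    exact mul_mem_relW_of_mem_relS hSg hl.1 (ih hl.2)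

theorem prod_mem_relW (hSg : GoodSubset cs Sg) {l : List W} (hl : ∀ x ∈ l, x ∈ relS cs Sg) :
    l.prod ∈ relW cs Sg := by
  simpa using prod_mul_mem_relW hSg hl (one_mem_relW hSg.1)

variable (cs) in
theorem length_prod_le (l : List W) : cs.length l.prod ≤ (l.map cs.length).sum := by
  induction l with
  | nil => simp
  | cons r l ih =>
    rw [List.prod_cons, List.map_cons, List.sum_cons]
    exact (cs.length_mul_le _ _).trans (by omega)

/-- Every element of `W̃` is a length-additive product of elements of `S̃`. -/
theorem exists_additive_word (hSg : GoodSubset cs Sg) {w : W} (hw : w ∈ relW cs Sg) :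
    ∃ l : List W, (∀ x ∈ l, x ∈ relS cs Sg) ∧ l.prod = w ∧
      cs.length w = (l.map cs.length).sum := by
  induction hn : cs.length w using Nat.strong_induction_on generalizing w with
  | _ n ih =>
    by_cases hw1 : w = 1
    · subst hw1
      exact ⟨[], by simp, by simp, by simpa using hn.symm⟩
    · obtain ⟨r, hr, hlen⟩ := exists_relS_descent hSg hw hw1
      have hpos := length_pos_of_mem_relS hSg hr
      obtain ⟨l, hl, hprod, hsum⟩ := ih (cs.length (r * w)) (by omega)
        (mul_mem_relW_of_mem_relS hSg hr hw) rfl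
      refine ⟨r :: l, by simpa using ⟨hr, hl⟩, ?_, ?_⟩
      · rw [List.prod_cons, hprod, ← mul_assoc, mul_self_of_mem_relS hSg hr, one_mul]
      · rw [List.map_cons, List.sum_cons]
        omega

/-- Exchange property for length-additive words in `S̃`. -/
theorem exists_shorter_word (hSg : GoodSubset cs Sg) {r : W} (hr : r ∈ relS cs Sg) {l : List W}
    (hl : ∀ x ∈ l, x ∈ relS cs Sg) (hadd : cs.length l.prod = (l.map cs.length).sum)
    (hdesc : cs.length (r * l.prod) + cs.length r = cs.length l.prod) :
    ∃ l' : List W, (∀ x ∈ l', x ∈ relS cs Sg) ∧ l'.prod = r * l.prod ∧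
      l'.length + 1 = l.length := by
  induction l using List.reverseRecOn with
  | nil =>
    have := length_pos_of_mem_relS hSg hr
    rw [List.prod_nil, cs.length_one] at hdesc
    omega
  | append_singleton l r' ih =>
    simp only [List.mem_append, List.mem_singleton, or_imp, forall_and, forall_eq] at hl
    obtain ⟨hl, hr'⟩ := hl
    simp only [List.prod_append, List.prod_singleton, List.map_append, List.map_cons,
      List.map_nil, List.sum_append, List.sum_singleton] at hadd hdesc
    have h1 := length_prod_le cs l
    have h2 := cs.length_mul_le l.prod r'
    have hp := prod_mem_relW hSg hl
    rcases length_mul_of_mem_relS hSg hr hp with h | h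
    · refine ⟨l, hl, ?_, by simp⟩
      have heq := relS_mul_eq_mul_relS hSg hr hr' hp h (by omega) hdesc
      rw [List.prod_append, List.prod_singleton, ← mul_assoc, heq, mul_assoc,
        mul_self_of_mem_relS hSg hr', mul_one]
    · obtain ⟨l', hl', hprod, hlen⟩ := ih hl (by omega) h
      refine ⟨l' ++ [r'], ?_, by simp [hprod, mul_assoc], by simp [hlen]⟩
      simp only [List.mem_append, List.mem_singleton]
      rintro x (hx | rfl)
      · exact hl' x hx
      · exact hr'

/-- A word in `S̃` of minimal length among all words with the same product is length-additive. -/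
theorem length_prod_eq_of_minimal (hSg : GoodSubset cs Sg) {l : List W}
    (hl : ∀ x ∈ l, x ∈ relS cs Sg)
    (hmin : ∀ l' : List W, (∀ x ∈ l', x ∈ relS cs Sg) → l'.prod = l.prod →
      l.length ≤ l'.length) : cs.length l.prod = (l.map cs.length).sum := by
  induction l with
  | nil => simp
  | cons r l ih =>
    rw [List.forall_mem_cons] at hl
    have hadd := ih hl.2 fun l' hl' hprod => by
      have := hmin (r :: l') (List.forall_mem_cons.2 ⟨hl.1, hl'⟩) (by simp [hprod])
      simpa using this
    rw [List.prod_cons, List.map_cons, List.sum_cons]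
    rcases length_mul_of_mem_relS hSg hl.1 (prod_mem_relW hSg hl.2) with h | h
    · omega
    · obtain ⟨l', hl', hprod, hlen⟩ := exists_shorter_word hSg hl.1 hl.2 hadd h
      have := hmin l' hl' (by rw [hprod, List.prod_cons])
      rw [List.length_cons] at this
      omega

/-- A length-additive word in `S̃` has minimal length among all words with the same product. -/
theorem length_le_of_additive (hSg : GoodSubset cs Sg) {l l' : List W}
    (hl : ∀ x ∈ l, x ∈ relS cs Sg) (hadd : cs.length l.prod = (l.map cs.length).sum)
    (hl' : ∀ x ∈ l', x ∈ relS cs Sg) (hprod : l'.prod = l.prod) : l.length ≤ l'.length := by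
  induction l generalizing l' with
  | nil => simp
  | cons r l ih =>
    obtain ⟨m, ⟨hm, hmprod⟩, hmmin⟩ := (measure (List.length (α := W))).wf.has_min
      {m | (∀ x ∈ m, x ∈ relS cs Sg) ∧ m.prod = (r :: l).prod} ⟨l', hl', hprod⟩
    have hmle : ∀ k : List W, (∀ x ∈ k, x ∈ relS cs Sg) → k.prod = (r :: l).prod →
        m.length ≤ k.length := fun k hk hkprod => not_lt.1 (hmmin k ⟨hk, hkprod⟩)
    rw [List.forall_mem_cons] at hl
    have hmadd := length_prod_eq_of_minimal hSg hm (by rwa [hmprod])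
    have hrr := mul_self_of_mem_relS hSg hl.1
    have h1 := length_prod_le cs l
    have h2 := cs.length_mul_le r l.prod
    rw [List.map_cons, List.sum_cons, List.prod_cons] at hadd
    have hrm : r * m.prod = l.prod := by
      rw [hmprod, List.prod_cons, ← mul_assoc, hrr, one_mul]
    obtain ⟨k, hk, hkprod, hklen⟩ := exists_shorter_word hSg hl.1 hm hmadd (by
      rw [hrm, hmprod, List.prod_cons]
      omega)
    have h3 := ih hl.2 (by omega) hk (hkprod.trans hrm)
    have h4 := hmle l' hl' hprod
    rw [List.length_cons]
    omega

theorem relLength_eq_of_additive (hSg : GoodSubset cs Sg) {l : List W}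
    (hl : ∀ x ∈ l, x ∈ relS cs Sg) (hadd : cs.length l.prod = (l.map cs.length).sum) :
    relLength cs Sg l.prod = l.length := by
  refine le_antisymm (sInf_le ⟨l, hl, rfl, rfl⟩) (le_sInf ?_)
  rintro _ ⟨l', hl', hprod, rfl⟩
  exact_mod_cast length_le_of_additive hSg hl hadd hl' hprod

end Words

end Relative

variable (cs)

/-- for `w, y ∈ W̃`, `ℓ̃(y) + ℓ̃(w) = ℓ̃(yw)` iff `ℓ(y) + ℓ(w) = ℓ(yw)`. -/
theorem relLength_add_iff_length_add (Sg : Set W) (hSg : GoodSubset cs Sg)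
    (w y : W) (hw : w ∈ relW cs Sg) (hy : y ∈ relW cs Sg) :
    relLength cs Sg y + relLength cs Sg w = relLength cs Sg (y * w) ↔
      cs.length y + cs.length w = cs.length (y * w) := by
  obtain ⟨ly, hly, rfl, hyadd⟩ := exists_additive_word hSg hy
  obtain ⟨lw, hlw, rfl, hwadd⟩ := exists_additive_word hSg hw
  have hl : ∀ x ∈ ly ++ lw, x ∈ relS cs Sg := fun x hx =>
    (List.mem_append.1 hx).elim (hly x) (hlw x)
  have hsum : ((ly ++ lw).map cs.length).sum = cs.length ly.prod + cs.length lw.prod := by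
    rw [List.map_append, List.sum_append, hyadd, hwadd]
  rw [relLength_eq_of_additive hSg hly hyadd, relLength_eq_of_additive hSg hlw hwadd,
    ← List.prod_append]
  constructor
  · intro h
    rw [length_prod_eq_of_minimal hSg hl, hsum]
    intro l' hl' hprod
    have hle : relLength cs Sg (ly ++ lw).prod ≤ l'.length := sInf_le ⟨l', hl', hprod, rfl⟩
    rw [← h] at hle
    rw [List.length_append]
    exact_mod_cast hle
  · intro h
    rw [relLength_eq_of_additive hSg hl (h.symm.trans hsum.symm), List.length_append]
    push_cast
    rfl

end RelativeCoxeter
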